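/- For all integers 1 ≤ m ≤ n, there exists a real number α' > 0 such that for every real α ≥ α', the function E_{m,n}^{−α} is completely monotone on the positive orthant ℝⁿ_{>0}, where E_{m,n}(x) = Σ_{1 ≤ i₁ < ⋯ < i_m ≤ n} x_{i₁}⋯x_{i_m} is the m-th elementary symmetric polynomial in n variables. -/

import Mathlib

open MeasureTheory Real Set

noncomputable def iterDirDeriv {E : Type*} [NormedAddCommGroup E] [NormedSpace ℝ E] :
    ℕ → (ℕ → E) → (E → ℝ) → E → ℝ
  | 0, _, f => f
  | (k+1), v, f => fun x => fderiv ℝ (iterDirDeriv k (fun i => v (i+1)) f) x (v 0)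

/-- A function is completely monotone on `C` if it is smooth on `C` and its iterated
directional derivatives along vectors of `C` satisfy the alternating sign condition. -/
def CompletelyMonotoneOn {E : Type*} [NormedAddCommGroup E] [NormedSpace ℝ E]
    (f : E → ℝ) (C : Set E) : Prop :=
  ContDiffOn ℝ (⊤ : ℕ∞) f C ∧
  ∀ (k : ℕ) (v : ℕ → E), (∀ i, v i ∈ C) → ∀ x ∈ C, 0 ≤ (-1 : ℝ) ^ k * iterDirDeriv k v f x

/-- All alternating finite differences of `f` of order at most `k` along nonnegative vectors are
nonnegative on the open positive orthant. -/
def AltDiffNonneg {ι : Type*} : ℕ → ((ι → ℝ) → ℝ) → Prop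
  | 0, f => ∀ x, (∀ i, 0 < x i) → 0 ≤ f x
  | (k+1), f => (∀ x, (∀ i, 0 < x i) → 0 ≤ f x) ∧
      ∀ h : ι → ℝ, 0 ≤ h → AltDiffNonneg k (fun x => f x - f (x + h))

/-- Complete monotonicity on the open positive orthant, phrased with finite differences. -/
def DiffCompletelyMonotone {ι : Type*} (f : (ι → ℝ) → ℝ) : Prop :=
  ∀ k, AltDiffNonneg k f

section Closure

variable {ι : Type*} {f g : (ι → ℝ) → ℝ} {k : ℕ}

theorem orthant_add {x h : ι → ℝ} (hx : ∀ i, 0 < x i) (hh : 0 ≤ h) : ∀ i, 0 < (x + h) i :=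
  fun i => add_pos_of_pos_of_nonneg (hx i) (hh i)

namespace AltDiffNonneg

theorem nonneg (hf : AltDiffNonneg k f) {x : ι → ℝ} (hx : ∀ i, 0 < x i) : 0 ≤ f x := by
  cases k with
  | zero => exact hf x hx
  | succ k => exact hf.1 x hx

theorem congr (hf : AltDiffNonneg k f) (h : ∀ x, (∀ i, 0 < x i) → f x = g x) :
    AltDiffNonneg k g := by
  induction k generalizing f g with
  | zero => exact fun x hx => h x hx ▸ hf x hx
  | succ k ih =>
    refine ⟨fun x hx => h x hx ▸ hf.1 x hx, fun v hv => ih (hf.2 v hv) fun x hx => ?_⟩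
    rw [h x hx, h _ (orthant_add hx hv)]

theorem of_succ (hf : AltDiffNonneg (k + 1) f) : AltDiffNonneg k f := by
  induction k generalizing f with
  | zero => exact hf.1
  | succ k ih => exact ⟨hf.1, fun v hv => ih (hf.2 v hv)⟩

theorem comp_add (hf : AltDiffNonneg k f) {h : ι → ℝ} (hh : 0 ≤ h) :
    AltDiffNonneg k (fun x => f (x + h)) := by
  induction k generalizing f with
  | zero => exact fun x hx => hf _ (orthant_add hx hh)
  | succ k ih =>
    refine ⟨fun x hx => hf.1 _ (orthant_add hx hh), fun v hv => ?_⟩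
    simpa only [add_right_comm _ v h] using ih (hf.2 v hv)

theorem add (hf : AltDiffNonneg k f) (hg : AltDiffNonneg k g) :
    AltDiffNonneg k (fun x => f x + g x) := by
  induction k generalizing f g with
  | zero => exact fun x hx => add_nonneg (hf x hx) (hg x hx)
  | succ k ih =>
    refine ⟨fun x hx => add_nonneg (hf.1 x hx) (hg.1 x hx), fun v hv => ?_⟩
    exact (ih (hf.2 v hv) (hg.2 v hv)).congr fun x _ => by ring

theorem mul (hf : AltDiffNonneg k f) (hg : AltDiffNonneg k g) :
    AltDiffNonneg k (fun x => f x * g x) := by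
  induction k generalizing f g with
  | zero => exact fun x hx => mul_nonneg (hf x hx) (hg x hx)
  | succ k ih =>
    refine ⟨fun x hx => mul_nonneg (hf.1 x hx) (hg.1 x hx), fun v hv => ?_⟩
    exact ((ih (hf.2 v hv) hg.of_succ).add (ih (hf.of_succ.comp_add hv) (hg.2 v hv))).congr
      fun x _ => by ring

theorem const {c : ℝ} (hc : 0 ≤ c) : AltDiffNonneg k (fun _ : ι → ℝ => c) := by
  induction k generalizing c with
  | zero => exact fun _ _ => hc
  | succ k ih => exact ⟨fun _ _ => hc, fun v _ => (ih le_rfl).congr fun _ _ => (sub_self c).symm⟩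

theorem of_tendsto {β : Type*} {l : Filter β} [l.NeBot] {F : β → (ι → ℝ) → ℝ}
    (hF : ∀ᶠ b in l, AltDiffNonneg k (F b))
    (hlim : ∀ x, (∀ i, 0 < x i) → Filter.Tendsto (fun b => F b x) l (nhds (f x))) :
    AltDiffNonneg k f := by
  induction k generalizing f F with
  | zero => exact fun x hx => ge_of_tendsto (hlim x hx) (hF.mono fun b hb => hb x hx)
  | succ k ih =>
    refine ⟨fun x hx => ge_of_tendsto (hlim x hx) (hF.mono fun b hb => hb.1 x hx), fun v hv => ?_⟩
    exact ih (hF.mono fun b hb => hb.2 v hv)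
      fun x hx => (hlim x hx).sub (hlim _ (orthant_add hx hv))

theorem integral {Ω : Type*} [MeasurableSpace Ω] {μ : Measure Ω} {F : Ω → (ι → ℝ) → ℝ}
    (hF : ∀ᵐ s ∂μ, AltDiffNonneg k (F s))
    (hint : ∀ x, (∀ i, 0 < x i) → Integrable (fun s => F s x) μ) :
    AltDiffNonneg k (fun x => ∫ s, F s x ∂μ) := by
  induction k generalizing F with
  | zero => exact fun x hx => integral_nonneg_of_ae (hF.mono fun s hs => hs x hx)
  | succ k ih =>
    refine ⟨fun x hx => integral_nonneg_of_ae (hF.mono fun s hs => hs.1 x hx), fun v hv => ?_⟩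
    refine (ih (hF.mono fun s hs => hs.2 v hv)
      fun x hx => (hint x hx).sub (hint _ (orthant_add hx hv))).congr fun x hx => ?_
    exact integral_sub (hint x hx) (hint _ (orthant_add hx hv))

theorem exp_neg {L : (ι → ℝ) → ℝ} (hadd : ∀ x y, L (x + y) = L x + L y)
    (hL : ∀ x, 0 ≤ x → 0 ≤ L x) : AltDiffNonneg k (fun x => exp (-L x)) := by
  induction k with
  | zero => exact fun x _ => (exp_pos _).le
  | succ k ih =>
    refine ⟨fun x _ => (exp_pos _).le, fun v hv => ?_⟩
    have hc : 0 ≤ 1 - exp (-L v) := by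
      have := Real.exp_le_one_iff.2 (neg_nonpos.2 (hL v hv))
      linarith
    refine ((const hc).mul ih).congr fun x _ => ?_
    simp only [hadd, neg_add, Real.exp_add]
    ring

end AltDiffNonneg

namespace DiffCompletelyMonotone

theorem congr (hf : DiffCompletelyMonotone f) (h : ∀ x, (∀ i, 0 < x i) → f x = g x) :
    DiffCompletelyMonotone g := fun k => (hf k).congr h

theorem mul (hf : DiffCompletelyMonotone f) (hg : DiffCompletelyMonotone g) :
    DiffCompletelyMonotone (fun x => f x * g x) := fun k => (hf k).mul (hg k)

theorem const {c : ℝ} (hc : 0 ≤ c) : DiffCompletelyMonotone (fun _ : ι → ℝ => c) :=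
  fun _ => .const hc

theorem pow (hf : DiffCompletelyMonotone f) (n : ℕ) :
    DiffCompletelyMonotone (fun x => f x ^ n) := by
  induction n with
  | zero => simpa using const (ι := ι) zero_le_one
  | succ n ih => simpa only [pow_succ] using ih.mul hf

theorem prod {κ : Type*} {s : Finset κ} {F : κ → (ι → ℝ) → ℝ}
    (hF : ∀ j ∈ s, DiffCompletelyMonotone (F j)) :
    DiffCompletelyMonotone (fun x => ∏ j ∈ s, F j x) := by
  classical
  induction s using Finset.induction_on with
  | empty => simpa using const (ι := ι) zero_le_one
  | insert a s ha ih =>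
    simp only [Finset.prod_insert ha]
    exact (hF a (Finset.mem_insert_self a s)).mul
      (ih fun j hj => hF j (Finset.mem_insert_of_mem hj))

theorem exp_neg_mul_coord {c : ℝ} (hc : 0 ≤ c) (a : ι) :
    DiffCompletelyMonotone (fun x : ι → ℝ => exp (-(c * x a))) := fun _ =>
  .exp_neg (L := fun x => c * x a) (fun x y => mul_add c (x a) (y a))
    fun _ hx => mul_nonneg hc (hx a)

/-- The negative of a directional derivative along a nonnegative vector. -/
theorem of_hasDerivAt (hf : DiffCompletelyMonotone f) {v : ι → ℝ} (hv : 0 ≤ v)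
    (hd : ∀ x, (∀ i, 0 < x i) → HasDerivAt (fun t : ℝ => f (x + t • v)) (-g x) 0) :
    DiffCompletelyMonotone g := by
  intro k
  refine .of_tendsto (l := nhdsWithin 0 (Ioi (0 : ℝ)))
    (F := fun t x => t⁻¹ * (f x - f (x + t • v))) ?_ fun x hx => ?_
  · filter_upwards [self_mem_nhdsWithin] with t ht
    exact (AltDiffNonneg.const (inv_nonneg.2 (le_of_lt ht))).mul
      ((hf (k + 1)).2 (t • v) (smul_nonneg (le_of_lt ht) hv))
  · have h := ((hd x hx).tendsto_slope_zero_right).neg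
    simp only [zero_add, zero_smul, add_zero, neg_neg, smul_eq_mul] at h
    exact h.congr fun t => by ring

end DiffCompletelyMonotone

end Closure

section Orthant

variable {ι : Type*}

theorem isOpen_orthant [Finite ι] : IsOpen {x : ι → ℝ | ∀ i, 0 < x i} := by
  simp only [ofPred_forall]
  exact isOpen_iInter_of_finite fun i => isOpen_lt continuous_const (continuous_apply i)

theorem DiffCompletelyMonotone.completelyMonotoneOn [Fintype ι] {f : (ι → ℝ) → ℝ}
    (hf : DiffCompletelyMonotone f) (hs : ContDiffOn ℝ (⊤ : ℕ∞) f {x | ∀ i, 0 < x i}) :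
    CompletelyMonotoneOn f {x | ∀ i, 0 < x i} := by
  have key : ∀ (k : ℕ) (v : ℕ → ι → ℝ), (∀ i, v i ∈ {x : ι → ℝ | ∀ i, 0 < x i}) →
      ContDiffOn ℝ (⊤ : ℕ∞) (iterDirDeriv k v f) {x | ∀ i, 0 < x i} ∧
      DiffCompletelyMonotone (fun x => (-1 : ℝ) ^ k * iterDirDeriv k v f x) := by
    intro k
    induction k with
    | zero => exact fun v _ => ⟨hs, hf.congr fun _ _ => by simp [iterDirDeriv]⟩
    | succ k ih =>
      intro v hv
      obtain ⟨h1, h2⟩ := ih (fun i => v (i + 1)) fun i => hv (i + 1)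
      refine ⟨(h1.fderiv_of_isOpen isOpen_orthant (by simp)).clm_apply contDiffOn_const, ?_⟩
      refine h2.of_hasDerivAt (v := v 0) (fun i => (hv 0 i).le) fun x hx => ?_
      have hd : HasFDerivAt (iterDirDeriv k (fun i => v (i + 1)) f)
          (fderiv ℝ (iterDirDeriv k (fun i => v (i + 1)) f) x) (x + (0 : ℝ) • v 0) := by
        rw [zero_smul, add_zero]
        exact ((h1.contDiffAt (isOpen_orthant.mem_nhds hx)).differentiableAt
          (by simp)).hasFDerivAt
      have hl : HasDerivAt (fun t : ℝ => x + t • v 0) (v 0) 0 := by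
        simpa using ((hasDerivAt_id (0 : ℝ)).smul_const (v 0)).const_add x
      refine ((hd.comp_hasDerivAt (0 : ℝ) hl).const_mul ((-1 : ℝ) ^ k)).congr_deriv ?_
      simp only [iterDirDeriv, pow_succ]
      ring
  exact ⟨hs, fun k v hv x hx => (key k v hv).2 0 x hx⟩

end Orthant

section Mixtures

variable {ι : Type*} {A B : (ι → ℝ) → ℝ}

theorem integrable_and_integral_gamma {α r : ℝ} (hα : 0 < α) (hr : 0 < r) :
    IntegrableOn (fun t : ℝ => t ^ (α - 1) * exp (-(r * t))) (Ioi 0) ∧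
      ∫ t in Ioi (0 : ℝ), t ^ (α - 1) * exp (-(r * t)) = r ^ (-α) * Real.Gamma α := by
  have h := Real.integral_rpow_mul_exp_neg_mul_Ioi hα hr
  rw [one_div, Real.inv_rpow hr.le, ← Real.rpow_neg hr.le] at h
  refine ⟨not_imp_comm.1 integral_undef ?_, h⟩
  rw [h]
  exact (mul_pos (rpow_pos_of_pos hr _) (Real.Gamma_pos_of_pos hα)).ne'

theorem diffCompletelyMonotone_rpow_linear
    (hA : ∀ x, (∀ i, 0 < x i) → 0 ≤ A x) (hB : ∀ x, (∀ i, 0 < x i) → 0 < B x)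
    {α : ℝ} (hα : 0 < α) (a : ι)
    (h : ∀ t, 0 ≤ t → DiffCompletelyMonotone (fun x => B x ^ (-α) * exp (-(t * (A x / B x))))) :
    DiffCompletelyMonotone (fun x => (x a * B x + A x) ^ (-α)) := by
  have hr : ∀ x : ι → ℝ, (∀ i, 0 < x i) → 0 < x a + A x / B x := fun x hx =>
    add_pos_of_pos_of_nonneg (hx a) (div_nonneg (hA x hx) (hB x hx).le)
  have heq : ∀ (x : ι → ℝ) (t : ℝ), t ^ (α - 1) *
      (exp (-(t * x a)) * (B x ^ (-α) * exp (-(t * (A x / B x))))) =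
      B x ^ (-α) * (t ^ (α - 1) * exp (-((x a + A x / B x) * t))) := by
    intro x t
    rw [show -((x a + A x / B x) * t) = -(t * x a) + -(t * (A x / B x)) by ring, Real.exp_add]
    ring
  intro k
  have hI : AltDiffNonneg k (fun x => ∫ t in Ioi (0 : ℝ), t ^ (α - 1) *
      (exp (-(t * x a)) * (B x ^ (-α) * exp (-(t * (A x / B x)))))) := by
    refine .integral ?_ fun x hx => ?_
    · filter_upwards [ae_restrict_mem measurableSet_Ioi] with t ht
      have ht' : (0 : ℝ) ≤ t := le_of_lt ht
      exact (AltDiffNonneg.const (rpow_nonneg ht' _)).mul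
        ((DiffCompletelyMonotone.exp_neg_mul_coord ht' a k).mul (h t ht' k))
    · simp only [heq]
      exact (integrable_and_integral_gamma hα (hr x hx)).1.const_mul _
  refine ((AltDiffNonneg.const (inv_nonneg.2 (Real.Gamma_pos_of_pos hα).le)).mul hI).congr
    fun x hx => ?_
  simp only [heq]
  rw [integral_const_mul, (integrable_and_integral_gamma hα (hr x hx)).2,
    show x a * B x + A x = B x * (x a + A x / B x) by
      have := (hB x hx).ne'
      field_simp,
    Real.mul_rpow (hB x hx).le (hr x hx).le]
  have := (Real.Gamma_pos_of_pos hα).ne'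
  field_simp

theorem integrable_and_integral_gaussian_shift {b : ℝ} (hb : 0 < b) (c : ℝ) :
    Integrable (fun s : ℝ => exp (-b * (s - c) ^ 2)) ∧
      ∫ s : ℝ, exp (-b * (s - c) ^ 2) = √(π / b) :=
  ⟨(integrable_exp_neg_mul_sq hb).comp_sub_right c,
    (integral_sub_right_eq_self (fun s : ℝ => exp (-b * s ^ 2)) c).trans (integral_gaussian b)⟩

/-- Adding a coordinate in parallel: `x a * A / (x a * B + A)` is the harmonic combination of
`x a` and `A / B`. -/
theorem diffCompletelyMonotone_parallel
    (hA : ∀ x, (∀ i, 0 < x i) → 0 ≤ A x) (hB : ∀ x, (∀ i, 0 < x i) → 0 < B x)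
    {β t : ℝ} (ht : 0 < t) (a : ι)
    (h : ∀ s, 0 ≤ s → DiffCompletelyMonotone
      (fun x => B x ^ (-(β + 1 / 2)) * exp (-(s * (A x / B x))))) :
    DiffCompletelyMonotone (fun x => B x ^ (-β) * (x a * B x + A x) ^ (-(1 / 2) : ℝ) *
      exp (-(t * (x a * A x / (x a * B x + A x))))) := by
  have hE : ∀ x : ι → ℝ, (∀ i, 0 < x i) → 0 < x a * B x + A x := fun x hx =>
    add_pos_of_pos_of_nonneg (mul_pos (hx a) (hB x hx)) (hA x hx)
  have heq : ∀ x : ι → ℝ, (∀ i, 0 < x i) → ∀ s : ℝ,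
      exp (-(t * s ^ 2 * x a)) *
        (B x ^ (-(β + 1 / 2)) * exp (-(t * (1 - s) ^ 2 * (A x / B x)))) =
      B x ^ (-(β + 1 / 2)) * exp (-(t * (x a * A x / (x a * B x + A x)))) *
        exp (-(t * ((x a * B x + A x) / B x)) * (s - A x / (x a * B x + A x)) ^ 2) := by
    intro x hx s
    have h1 := (hB x hx).ne'
    have h2 := (hE x hx).ne'
    have : -(t * s ^ 2 * x a) + -(t * (1 - s) ^ 2 * (A x / B x)) =
        -(t * (x a * A x / (x a * B x + A x))) +
        -(t * ((x a * B x + A x) / B x)) * (s - A x / (x a * B x + A x)) ^ 2 := by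
      field_simp
      ring
    rw [mul_left_comm, ← Real.exp_add, this, Real.exp_add, mul_assoc]
  have hb : ∀ x : ι → ℝ, (∀ i, 0 < x i) → 0 < t * ((x a * B x + A x) / B x) := fun x hx =>
    mul_pos ht (div_pos (hE x hx) (hB x hx))
  intro k
  have hI : AltDiffNonneg k (fun x => ∫ s : ℝ, exp (-(t * s ^ 2 * x a)) *
      (B x ^ (-(β + 1 / 2)) * exp (-(t * (1 - s) ^ 2 * (A x / B x))))) := by
    refine .integral (.of_forall fun s => ?_) fun x hx => ?_
    · exact (DiffCompletelyMonotone.exp_neg_mul_coord (by positivity) a k).mul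
        (h _ (by positivity) k)
    · simp only [heq x hx]
      exact (integrable_and_integral_gaussian_shift (hb x hx) _).1.const_mul _
  refine ((AltDiffNonneg.const (c := √(t / π)) (sqrt_nonneg _)).mul hI).congr fun x hx => ?_
  simp only [heq x hx]
  rw [integral_const_mul, (integrable_and_integral_gaussian_shift (hb x hx) _).2]
  have h1 := hB x hx
  have h2 := hE x hx
  have hs : √(t / π) * √(π / (t * ((x a * B x + A x) / B x))) =
      B x ^ (1 / 2 : ℝ) * (x a * B x + A x) ^ (-(1 / 2) : ℝ) := by
    rw [← Real.sqrt_mul (by positivity), Real.rpow_neg h2.le, ← Real.sqrt_eq_rpow,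
      ← Real.sqrt_eq_rpow, ← div_eq_mul_inv, ← Real.sqrt_div h1.le]
    congr 1
    field_simp
  have hp : B x ^ (-(β + 1 / 2)) * B x ^ (1 / 2 : ℝ) = B x ^ (-β) := by
    rw [← Real.rpow_add h1]
    congr 1
    ring
  rw [← hp]
  linear_combination (B x ^ (-(β + 1 / 2)) * exp (-(t * (x a * A x / (x a * B x + A x))))) * hs

/-- Differentiating a negative power of `x a * B + A`, where `A` and `B` do not involve `x a`. -/
theorem diffCompletelyMonotone_rpow_mul_coeff [DecidableEq ι]
    (hA : ∀ x, (∀ i, 0 < x i) → 0 ≤ A x) (hB : ∀ x, (∀ i, 0 < x i) → 0 < B x) (a : ι)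
    (hA' : ∀ x (t : ℝ), A (x + t • Pi.single a 1) = A x)
    (hB' : ∀ x (t : ℝ), B (x + t • Pi.single a 1) = B x) {α : ℝ} (hα : 0 < α)
    (h : DiffCompletelyMonotone (fun x => (x a * B x + A x) ^ (-α))) :
    DiffCompletelyMonotone (fun x => (x a * B x + A x) ^ (-(α + 1)) * B x) := by
  have hd : DiffCompletelyMonotone (fun x => α * ((x a * B x + A x) ^ (-(α + 1)) * B x)) := by
    refine h.of_hasDerivAt (v := Pi.single a 1) (Pi.single_nonneg.2 zero_le_one) fun x hx => ?_
    have hE : 0 < x a * B x + A x :=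
      add_pos_of_pos_of_nonneg (mul_pos (hx a) (hB x hx)) (hA x hx)
    simp only [hA', hB', Pi.add_apply, Pi.smul_apply, Pi.single_eq_same, smul_eq_mul, mul_one]
    have h1 : HasDerivAt (fun t : ℝ => (x a + t) * B x + A x) (B x) 0 := by
      simpa using (((hasDerivAt_id (0 : ℝ)).const_add (x a)).mul_const (B x)).add_const (A x)
    refine (h1.rpow_const (p := -α) (Or.inl (by simpa using hE.ne'))).congr_deriv ?_
    rw [add_zero, show -α - 1 = -(α + 1) by ring]
    ring
  refine ((DiffCompletelyMonotone.const (inv_nonneg.2 hα.le)).mul hd).congr fun x _ => ?_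
  field_simp

end Mixtures

section Esymm

variable {ι : Type*}

/-- The elementary symmetric polynomial of degree `m` in the variables indexed by `S`. -/
def esymmOn (m : ℕ) (S : Finset ι) (x : ι → ℝ) : ℝ :=
  ∑ T ∈ Finset.powersetCard m S, ∏ i ∈ T, x i

@[simp]
theorem esymmOn_zero (S : Finset ι) (x : ι → ℝ) : esymmOn 0 S x = 1 := by
  simp [esymmOn]

theorem esymmOn_nonneg (m : ℕ) (S : Finset ι) {x : ι → ℝ} (hx : ∀ i, 0 < x i) :
    0 ≤ esymmOn m S x :=
  Finset.sum_nonneg fun _ _ => Finset.prod_nonneg fun i _ => (hx i).le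

theorem esymmOn_pos {m : ℕ} {S : Finset ι} (hm : m ≤ S.card) {x : ι → ℝ} (hx : ∀ i, 0 < x i) :
    0 < esymmOn m S x :=
  Finset.sum_pos (fun _ _ => Finset.prod_pos fun i _ => hx i) (Finset.powersetCard_nonempty.2 hm)

variable [DecidableEq ι]

theorem esymmOn_insert (m : ℕ) {S : Finset ι} {a : ι} (ha : a ∉ S) (x : ι → ℝ) :
    esymmOn (m + 1) (insert a S) x = x a * esymmOn m S x + esymmOn (m + 1) S x := by
  have hmem : ∀ {j : ℕ} {T : Finset ι}, T ∈ Finset.powersetCard j S → a ∉ T := fun hT haT =>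
    ha ((Finset.mem_powersetCard.1 hT).1 haT)
  unfold esymmOn
  rw [Finset.powersetCard_succ_insert ha, Finset.sum_union, Finset.sum_image, add_comm,
    Finset.mul_sum]
  · congr 1
    exact Finset.sum_congr rfl fun T hT => Finset.prod_insert (hmem hT)
  · intro T hT U hU h
    rw [← Finset.erase_insert (hmem hT), h, Finset.erase_insert (hmem hU)]
  · refine Finset.disjoint_left.2 fun T hT hT' => ?_
    obtain ⟨U, -, rfl⟩ := Finset.mem_image.1 hT'
    exact hmem hT (Finset.mem_insert_self a U)

theorem esymmOn_of_mem (m : ℕ) {S : Finset ι} {a : ι} (ha : a ∈ S) (x : ι → ℝ) :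
    esymmOn (m + 1) S x = x a * esymmOn m (S.erase a) x + esymmOn (m + 1) (S.erase a) x := by
  rw [← esymmOn_insert m (Finset.notMem_erase a S), Finset.insert_erase ha]

theorem esymmOn_add_smul_single (m : ℕ) {S : Finset ι} {a : ι} (ha : a ∉ S) (x : ι → ℝ) (t : ℝ) :
    esymmOn m S (x + t • Pi.single a 1) = esymmOn m S x := by
  refine Finset.sum_congr rfl fun T hT => Finset.prod_congr rfl fun i hi => ?_
  have : i ≠ a := fun h => ha (h ▸ (Finset.mem_powersetCard.1 hT).1 hi)
  simp [this]

theorem sum_mul_esymmOn_erase (m : ℕ) (S : Finset ι) (x : ι → ℝ) :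
    ∑ i ∈ S, x i * esymmOn m (S.erase i) x = (m + 1) * esymmOn (m + 1) S x := by
  induction S using Finset.induction_on generalizing m with
  | empty =>
    have : Finset.powersetCard (m + 1) (∅ : Finset ι) = ∅ :=
      Finset.powersetCard_eq_empty.2 (by simp)
    simp [esymmOn, this]
  | insert a S ha ih =>
    rw [Finset.sum_insert ha, Finset.erase_insert ha, esymmOn_insert m ha]
    have herase : ∀ i ∈ S, (insert a S).erase i = insert a (S.erase i) := fun i hi =>
      Finset.erase_insert_of_ne fun h => ha (h ▸ hi)
    cases m with
    | zero =>
      have := ih 0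
      simp only [esymmOn_zero] at this ⊢
      rw [this]
      ring
    | succ m =>
      have : ∑ i ∈ S, x i * esymmOn (m + 1) ((insert a S).erase i) x =
          x a * ∑ i ∈ S, x i * esymmOn m (S.erase i) x +
            ∑ i ∈ S, x i * esymmOn (m + 1) (S.erase i) x := by
        rw [Finset.mul_sum, ← Finset.sum_add_distrib]
        refine Finset.sum_congr rfl fun i hi => ?_
        rw [herase i hi, esymmOn_insert m fun h => ha (Finset.mem_of_mem_erase h)]
        ring
      rw [this, ih, ih]
      push_cast
      ring

/-- If `α` is large then `E ^ (-α) * exp (-t * (F / E))` is completely monotone, where `E` and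
`F` are the elementary symmetric polynomials in `S` of degrees `m` and `m + 1`. -/
def EsymmQuotientMonotone (m : ℕ) (S : Finset ι) : Prop :=
  ∃ α' : ℝ, 0 < α' ∧ ∀ α, α' ≤ α → ∀ t : ℝ, 0 ≤ t → DiffCompletelyMonotone
    (fun x => esymmOn m S x ^ (-α) * exp (-(t * (esymmOn (m + 1) S x / esymmOn m S x))))

theorem exists_diffCompletelyMonotone_esymmOn_rpow {m : ℕ} {S : Finset ι} (hS : m + 1 ≤ S.card)
    (hQ : ∀ a ∈ S, EsymmQuotientMonotone m (S.erase a)) :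
    ∃ α' : ℝ, 0 < α' ∧ ∀ α, α' ≤ α →
      DiffCompletelyMonotone (fun x => esymmOn (m + 1) S x ^ (-α)) := by
  obtain ⟨a, ha⟩ := Finset.card_pos.1 (Nat.lt_of_lt_of_le m.succ_pos hS)
  obtain ⟨α', hα', h⟩ := hQ a ha
  refine ⟨α', hα', fun α hα => ?_⟩
  simp only [esymmOn_of_mem m ha]
  exact diffCompletelyMonotone_rpow_linear (fun x hx => esymmOn_nonneg _ _ hx)
    (fun x hx => esymmOn_pos (by rw [Finset.card_erase_of_mem ha]; omega) hx)
    (hα'.trans_le hα) a (h α hα)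

theorem exists_diffCompletelyMonotone_esymmOn_parallel {m : ℕ} {S : Finset ι}
    (hS : m + 1 ≤ S.card) {a : ι} (ha : a ∈ S) (hQ : EsymmQuotientMonotone m (S.erase a))
    {α : ℝ} (hα : 0 < α) (hP : DiffCompletelyMonotone (fun x => esymmOn (m + 1) S x ^ (-α))) :
    ∃ γ : ℝ, 0 < γ ∧ ∀ t, 0 < t → DiffCompletelyMonotone (fun x => esymmOn (m + 1) S x ^ (-γ) *
      exp (-(t * (x a * esymmOn (m + 1) (S.erase a) x / esymmOn (m + 1) S x)))) := by
  obtain ⟨α', -, h⟩ := hQ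
  obtain ⟨k, hk⟩ := exists_nat_ge α'
  have hB : ∀ x : ι → ℝ, (∀ i, 0 < x i) → 0 < esymmOn m (S.erase a) x := fun x hx =>
    esymmOn_pos (by rw [Finset.card_erase_of_mem ha]; omega) hx
  have hA : ∀ x : ι → ℝ, (∀ i, 0 < x i) → 0 ≤ esymmOn (m + 1) (S.erase a) x := fun x hx =>
    esymmOn_nonneg _ _ hx
  have hD : DiffCompletelyMonotone
      (fun x => esymmOn (m + 1) S x ^ (-(α + 1)) * esymmOn m (S.erase a) x) := by
    simp only [esymmOn_of_mem m ha] at hP ⊢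
    exact diffCompletelyMonotone_rpow_mul_coeff hA hB a
      (esymmOn_add_smul_single _ (Finset.notMem_erase a S))
      (esymmOn_add_smul_single _ (Finset.notMem_erase a S)) hα hP
  refine ⟨1 / 2 + (α + 1) * k, by positivity, fun t ht => ?_⟩
  have hpar := diffCompletelyMonotone_parallel hA hB (β := k) ht a (h (k + 1 / 2) (by linarith))
  simp only [← esymmOn_of_mem m ha] at hpar
  refine (hpar.mul (hD.pow k)).congr fun x hx => ?_
  have hE := esymmOn_pos hS hx
  have h1 : esymmOn m (S.erase a) x ^ (-(k : ℝ)) * esymmOn m (S.erase a) x ^ k = 1 := by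
    rw [← Real.rpow_natCast, ← Real.rpow_add (hB x hx), neg_add_cancel, Real.rpow_zero]
  have h2 : esymmOn (m + 1) S x ^ (-(1 / 2 + (α + 1) * k)) =
      esymmOn (m + 1) S x ^ (-(1 / 2) : ℝ) * (esymmOn (m + 1) S x ^ (-(α + 1))) ^ k := by
    rw [← Real.rpow_natCast, ← Real.rpow_mul hE.le, ← Real.rpow_add hE]
    congr 1
    ring
  rw [h2, mul_pow]
  linear_combination (esymmOn (m + 1) S x ^ (-(1 / 2) : ℝ) *
    (esymmOn (m + 1) S x ^ (-(α + 1))) ^ k *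
    exp (-(t * (x a * esymmOn (m + 1) (S.erase a) x / esymmOn (m + 1) S x)))) * h1

theorem esymmQuotientMonotone_succ {m : ℕ} {S : Finset ι} (hS : m + 1 ≤ S.card)
    (hQ : ∀ a ∈ S, EsymmQuotientMonotone m (S.erase a)) : EsymmQuotientMonotone (m + 1) S := by
  obtain ⟨α₀, hα₀, hP⟩ := exists_diffCompletelyMonotone_esymmOn_rpow hS hQ
  choose! γ hγ hpar using fun a ha => exists_diffCompletelyMonotone_esymmOn_parallel hS ha
    (hQ a ha) hα₀ (hP α₀ le_rfl)
  have hγ_nonneg : 0 ≤ ∑ a ∈ S, γ a := Finset.sum_nonneg fun a ha => (hγ a ha).le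
  refine ⟨∑ a ∈ S, γ a + α₀, by positivity, fun α hα t ht => ?_⟩
  rcases ht.eq_or_lt with rfl | ht
  · simpa using hP α (by linarith)
  have hm : (0 : ℝ) < m + 1 + 1 := by positivity
  refine ((hP (α - ∑ a ∈ S, γ a) (by linarith)).mul (.prod (s := S)
    fun a ha => hpar a ha (t / (m + 1 + 1)) (div_pos ht hm))).congr fun x hx => ?_
  have hE := esymmOn_pos hS hx
  have hsum := sum_mul_esymmOn_erase (m + 1) S x
  push_cast at hsum
  rw [Finset.prod_mul_distrib, ← Real.exp_sum, ← Real.rpow_sum_of_pos hE, ← mul_assoc,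
    ← Real.rpow_add hE, Finset.sum_neg_distrib, Finset.sum_neg_distrib, ← Finset.mul_sum,
    ← Finset.sum_div, hsum]
  congr 2
  · ring
  · field_simp

theorem esymmQuotientMonotone (m : ℕ) (S : Finset ι) (hS : m ≤ S.card) :
    EsymmQuotientMonotone m S := by
  induction m generalizing S with
  | zero =>
    refine ⟨1, one_pos, fun α _ t ht => ?_⟩
    refine (DiffCompletelyMonotone.prod (s := S)
      fun a _ => .exp_neg_mul_coord ht a).congr fun x _ => ?_
    have := sum_mul_esymmOn_erase 0 S x
    simp only [esymmOn_zero, mul_one, Nat.cast_zero, zero_add, one_mul] at this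
    rw [← Real.exp_sum, Finset.sum_neg_distrib, ← Finset.mul_sum, this]
    simp
  | succ m ih =>
    exact esymmQuotientMonotone_succ hS fun a ha =>
      ih _ (by rw [Finset.card_erase_of_mem ha]; omega)

end Esymm

/-- For all `1 ≤ m ≤ n` there exists `α' > 0` such that for every `α ≥ α'`
the function `E_{m,n}^{−α}` is completely monotone on the positive orthant, where `E_{m,n}`
is the `m`-th elementary symmetric polynomial in `n` variables. -/
theorem statement17 (n m : ℕ) (hm1 : 1 ≤ m) (hmn : m ≤ n) :
    ∃ α' : ℝ, 0 < α' ∧ ∀ α : ℝ, α' ≤ α →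
      CompletelyMonotoneOn
        (fun x : Fin n → ℝ =>
          (∑ S ∈ Finset.powersetCard m (Finset.univ : Finset (Fin n)), ∏ i ∈ S, x i) ^ (-α))
        {x : Fin n → ℝ | ∀ i, 0 < x i} := by
  obtain ⟨m, rfl⟩ := Nat.exists_eq_succ_of_ne_zero (Nat.one_le_iff_ne_zero.1 hm1)
  have hS : m + 1 ≤ (Finset.univ : Finset (Fin n)).card := by simpa using hmn
  obtain ⟨α', hα', h⟩ := exists_diffCompletelyMonotone_esymmOn_rpow hS fun a ha =>
    esymmQuotientMonotone m _ (by rw [Finset.card_erase_of_mem ha]; omega)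
  refine ⟨α', hα', fun α hα => (h α hα).completelyMonotoneOn ?_⟩
  refine ContDiffOn.rpow_const_of_ne ?_ fun x hx => (esymmOn_pos hS hx).ne'
  exact ContDiff.contDiffOn (.sum fun T _ => contDiff_prod fun i _ => contDiff_apply ℝ ℝ i)
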